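/- arXiv:2408.03918 — 3 statements merged into one kernel-verified Lean document; each statement's English description precedes it below -/
import Mathlib

section
/- Let f : ℝ^{n_x} × ℝ^{n_u} → ℝ^{n_x}, let (x_s, u_s) be an equilibrium pair (f(x_s,u_s) = x_s), let Z ⊆ ℝ^{n_x} × ℝ^{n_u}, let (Āᵢ,B̄ᵢ), i = 1,…,n_d, be matrices of sizes n_x×n_x and n_x×n_u, and let c > 0 be any positive real number. Then the matrices define a polytopic LDI for f on Z around (x_s,u_s) — i.e. for every (x,u) ∈ Z, f(x,u) − x_s lies in the convex hull of {Āᵢ(x − x_s) + B̄ᵢ(u − u_s) : i = 1,…,n_d} — if and only if for every (x,u) ∈ Z and every (y,t) ∈ ℝ^{n_x} × ℝ with ‖y‖² + t² ≤ c and ⟨Āᵢ(x − x_s) + B̄ᵢ(u − u_s), y⟩ + t ≥ 0 for all i, one has ⟨f(x,u) − x_s, y⟩ + t ≥ 0. In other words, adding the norm constraint ∑ⱼ yⱼ² ≤ c on the dual vector (for any c > 0) does not change the certification: the optimization problem with the norm constraint has nonnegative global optimal value if and only if the LDI property holds. -/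
open Matrix

/-- A point lies in the convex hull of a finite family in `ℝⁿ` iff every affine functional with
coefficient vector of squared Euclidean norm at most `c` that is nonnegative on the family is
nonnegative at the point. -/
theorem mem_convexHull_range_iff_forall_affine_nonneg {ι κ : Type*} [Finite ι] [Fintype κ]
    (v : ι → κ → ℝ) (w : κ → ℝ) {c : ℝ} (hc : 0 < c) :
    w ∈ convexHull ℝ (Set.range v) ↔
      ∀ (y : κ → ℝ) (t : ℝ), (∑ j, (y j) ^ 2) + t ^ 2 ≤ c →
        (∀ i, v i ⬝ᵥ y + t ≥ 0) → w ⬝ᵥ y + t ≥ 0 := by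
  classical
  refine ⟨fun hw y t _ hv => ?_, fun h => ?_⟩
  · have hconv : Convex ℝ {x : κ → ℝ | -t ≤ x ⬝ᵥ y} :=
      convex_halfSpace_ge
        ⟨fun a b => add_dotProduct a b y, fun r a => smul_dotProduct r a y⟩ (-t)
    have hsub : Set.range v ⊆ {x : κ → ℝ | -t ≤ x ⬝ᵥ y} := by
      rintro _ ⟨i, rfl⟩
      have := hv i
      simp only [Set.mem_ofPred_eq]
      linarith
    have hmem : -t ≤ w ⬝ᵥ y := convexHull_min hsub hconv hw
    linarith
  · by_contra hw
    obtain ⟨g, u, hgw, hgv⟩ := geometric_hahn_banach_point_closed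
      (convex_convexHull ℝ (Set.range v)) ((Set.finite_range v).isClosed_convexHull ℝ) hw
    set y : κ → ℝ := fun j => g (Pi.single j 1) with hy
    have hg : ∀ x, g x = x ⬝ᵥ y := fun x => by
      conv_lhs => rw [pi_eq_sum_univ' x]
      simp only [map_sum, map_smul, smul_eq_mul, dotProduct, hy]
    set N : ℝ := (∑ j, (y j) ^ 2) + u ^ 2 with hN
    have hN0 : 0 ≤ N := by positivity
    set k : ℝ := √(c / (N + 1)) with hk
    have hk0 : 0 < k := Real.sqrt_pos.2 (by positivity)
    have hk2 : k ^ 2 = c / (N + 1) := Real.sq_sqrt (by positivity)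
    have hnorm : (∑ j, ((k • y) j) ^ 2) + (k * -u) ^ 2 ≤ c := by
      have hscale : (∑ j, ((k • y) j) ^ 2) + (k * -u) ^ 2 = k ^ 2 * N := by
        simp only [Pi.smul_apply, smul_eq_mul, mul_pow, ← Finset.mul_sum, hN]
        ring
      rw [hscale, hk2, div_mul_eq_mul_div, div_le_iff₀ (by positivity)]
      nlinarith
    have hpos := h (k • y) (k * -u) hnorm fun i => by
      have := hgv (v i) (subset_convexHull ℝ _ ⟨i, rfl⟩)
      rw [hg] at this
      rw [dotProduct_smul, smul_eq_mul]
      nlinarith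
    rw [dotProduct_smul, smul_eq_mul] at hpos
    rw [hg] at hgw
    nlinarith

/-- Adding the norm constraint `∑ⱼ yⱼ² + t² ≤ c` (for any fixed `c > 0`) on the
dual variables does not change the certification: the matrices `(Āᵢ, B̄ᵢ)` define
a polytopic LDI for `f` on `Z` around `(x_s, u_s)` if and only if the
norm-constrained certification problem has nonnegative global optimal value. -/
theorem ldi_iff_certification_norm_constrained {n_x n_u n_d : ℕ}
    (f : (Fin n_x → ℝ) → (Fin n_u → ℝ) → (Fin n_x → ℝ))
    (x_s : Fin n_x → ℝ) (u_s : Fin n_u → ℝ)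
    (h_eq : f x_s u_s = x_s)
    (Z : Set ((Fin n_x → ℝ) × (Fin n_u → ℝ)))
    (A : Fin n_d → Matrix (Fin n_x) (Fin n_x) ℝ)
    (B : Fin n_d → Matrix (Fin n_x) (Fin n_u) ℝ)
    (c : ℝ) (hc : 0 < c) :
    (∀ p ∈ Z, f p.1 p.2 - x_s ∈
        convexHull ℝ
          (Set.range fun i : Fin n_d =>
            (A i).mulVec (p.1 - x_s) + (B i).mulVec (p.2 - u_s))) ↔
      (∀ p ∈ Z, ∀ (y : Fin n_x → ℝ) (t : ℝ),
        (∑ j, (y j) ^ 2) + t ^ 2 ≤ c →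
        (∀ i, ((A i).mulVec (p.1 - x_s) + (B i).mulVec (p.2 - u_s)) ⬝ᵥ y + t ≥ 0) →
          (f p.1 p.2 - x_s) ⬝ᵥ y + t ≥ 0) := by
  exact forall₂_congr fun p _ => mem_convexHull_range_iff_forall_affine_nonneg _ _ hc
end

section
/- Consider the map f : ℝ² → ℝ², f(x₁,x₂) = (2^{x₁} + x₂, x₁ + 2x₂), with equilibrium x_s = (1, −1) (i.e. f(x_s) = x_s), and the two matrices Ā₁ = [[0.174, 1],[1, 2]] and Ā₂ = [[2.77, 1],[1, 2]] obtained from the mean value theorem by bounding 2^{x₁} ln 2 for x₁ ∈ [−2,2]. Then {Ā₁, Ā₂} is a linear difference inclusion for f on [−2,2]² around x_s: for every x ∈ [−2,2] × [−2,2], the vector f(x) − x_s lies in the convex hull of {Ā₁ (x − x_s), Ā₂ (x − x_s)}. -/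
open Matrix

/-- On `[-2, 2]` the graph of `t ↦ 2 ^ t` lies between its tangent at `1` and the chords from `1`
to the endpoints, so its secant slopes at `1` lie in `[0.174, 2.77]`. -/
theorem exists_secant_slope_two_rpow {t : ℝ} (ht : t ∈ Set.Icc (-2 : ℝ) 2) :
    ∃ c ∈ Set.Icc (0.174 : ℝ) 2.77, (2 : ℝ) ^ t - 2 = c * (t - 1) := by
  obtain ⟨hl, hu⟩ := ht
  have htwo : (2 : ℝ) ^ t = 2 * 2 ^ (t - 1) := by
    rw [Real.rpow_sub_one two_ne_zero]; ring
  have htangent : 1 + (t - 1) * Real.log 2 ≤ (2 : ℝ) ^ (t - 1) := by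
    rw [Real.rpow_def_of_pos two_pos]
    linarith [Real.add_one_le_exp (Real.log 2 * (t - 1))]
  have hlog_gt := Real.log_two_gt_d9
  have hlog_lt := Real.log_two_lt_d9
  rcases lt_trichotomy t 1 with h | rfl | h
  · have hchord : (2 : ℝ) ^ (t - 1) ≤ 1 + (1 - t) / 3 * (-7 / 8) := by
      have hb := rpow_one_add_le_one_add_mul_self (s := (-7 / 8 : ℝ)) (p := (1 - t) / 3)
        (by norm_num) (by linarith) (by linarith)
      have hbase : (1 + -7 / 8 : ℝ) = (2 : ℝ) ^ (-3 : ℝ) := by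
        rw [Real.rpow_neg two_pos.le]; norm_num
      rwa [hbase, ← Real.rpow_mul two_pos.le,
        show (-3 : ℝ) * ((1 - t) / 3) = t - 1 by ring] at hb
    have hneg : t - 1 < 0 := by linarith
    refine ⟨((2 : ℝ) ^ t - 2) / (t - 1), ⟨?_, ?_⟩, (div_mul_cancel₀ _ hneg.ne).symm⟩
    · rw [le_div_iff_of_neg hneg]; linarith
    · rw [div_le_iff_of_neg hneg]; nlinarith
  · exact ⟨1, by norm_num, by norm_num⟩
  · have hchord : (2 : ℝ) ^ (t - 1) ≤ 1 + (t - 1) := by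
      have hb := rpow_one_add_le_one_add_mul_self (s := (1 : ℝ)) (p := t - 1)
        (by norm_num) (by linarith) (by linarith)
      rwa [one_add_one_eq_two, mul_one] at hb
    have hpos : 0 < t - 1 := by linarith
    refine ⟨((2 : ℝ) ^ t - 2) / (t - 1), ⟨?_, ?_⟩, (div_mul_cancel₀ _ hpos.ne').symm⟩
    · rw [le_div_iff₀ hpos]; nlinarith
    · rw [div_le_iff₀ hpos]; linarith

/-- For the system `f(x₁,x₂) = (2^{x₁} + x₂, x₁ + 2x₂)` on `[−2,2]²` with
equilibrium `x_s = (1,−1)`, the matrices `Ā₁ = [[0.174,1],[1,2]]` and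
`Ā₂ = [[2.77,1],[1,2]]` obtained via the mean value theorem form a linear
difference inclusion around `x_s`: `f(x) − x_s ∈ Co{Ā₁(x − x_s), Ā₂(x − x_s)}`
for every `x ∈ [−2,2]²`. -/
theorem mvt_ldi :
    ∀ x : Fin 2 → ℝ, x 0 ∈ Set.Icc (-2 : ℝ) 2 → x 1 ∈ Set.Icc (-2 : ℝ) 2 →
      (![(2 : ℝ) ^ (x 0) + x 1, x 0 + 2 * x 1] - ![(1 : ℝ), -1]) ∈
        convexHull ℝ
          {(!![(0.174 : ℝ), 1; 1, 2]).mulVec (x - ![(1 : ℝ), -1]),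
           (!![(2.77 : ℝ), 1; 1, 2]).mulVec (x - ![(1 : ℝ), -1])} := by
  intro x hx _
  obtain ⟨c, ⟨hc₁, hc₂⟩, hc⟩ := exists_secant_slope_two_rpow hx
  rw [convexHull_pair]
  refine ⟨(2.77 - c) / 2.596, (c - 0.174) / 2.596, div_nonneg (by linarith) (by norm_num),
    div_nonneg (by linarith) (by norm_num), by ring, ?_⟩
  ext i
  fin_cases i
  · simp [Matrix.vecHead, Matrix.vecTail]
    linear_combination -hc
  · simp [Matrix.vecHead, Matrix.vecTail]
    ring
end

section
/- Consider the map f : ℝ² → ℝ², f(x₁,x₂) = (2^{x₁} + x₂, x₁ + 2x₂), with equilibrium x_s = (1, −1), and the two matrices Ā₁ = [[0.5, 1],[1, 2]] and Ā₂ = [[2, 1],[1, 2]]. Then {Ā₁, Ā₂} is a (tighter) linear difference inclusion for f on [−2,2]² around x_s: for every x ∈ [−2,2] × [−2,2], the vector f(x) − x_s lies in the convex hull of {Ā₁ (x − x_s), Ā₂ (x − x_s)}. -/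
open Matrix

lemma secant_slope_two_rpow_mem_Icc {u : ℝ} (hu : u ∈ Set.Icc (-2 : ℝ) 2) (hu1 : u ≠ 1) :
    ((2 : ℝ) ^ u - 2) / (u - 1) ∈ Set.Icc (0.5 : ℝ) 2 := by
  have hconv : ConvexOn ℝ Set.univ fun t : ℝ ↦ (2 : ℝ) ^ t := convexOn_rpow_left two_pos
  have hleft := hconv.secant_mono (Set.mem_univ 1) (Set.mem_univ (-2)) (Set.mem_univ u)
    (by norm_num) hu1 hu.1
  have hright := hconv.secant_mono (Set.mem_univ 1) (Set.mem_univ u) (Set.mem_univ 2)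
    hu1 (by norm_num) hu.2
  have hneg : (2 : ℝ) ^ (-2 : ℝ) = 1 / 4 := by
    rw [Real.rpow_neg zero_le_two, Real.rpow_two]
    norm_num
  simp only [hneg, Real.rpow_one, Real.rpow_two] at hleft hright
  constructor
  · linarith
  · linarith

lemma exists_two_rpow_sub_two_eq_mul {u : ℝ} (hu : u ∈ Set.Icc (-2 : ℝ) 2) :
    ∃ s ∈ Set.Icc (0.5 : ℝ) 2, (2 : ℝ) ^ u - 2 = s * (u - 1) := by
  rcases eq_or_ne u 1 with rfl | hu1
  · exact ⟨2, by norm_num, by norm_num⟩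
  · exact ⟨_, secant_slope_two_rpow_mem_Icc hu hu1, (div_mul_cancel₀ _ (sub_ne_zero.2 hu1)).symm⟩

/-- For the system `f(x₁,x₂) = (2^{x₁} + x₂, x₁ + 2x₂)` on `[−2,2]²` with
equilibrium `x_s = (1,−1)`, the tighter matrices `Ā₁ = [[0.5,1],[1,2]]` and
`Ā₂ = [[2,1],[1,2]]` form a linear difference inclusion around `x_s`:
`f(x) − x_s ∈ Co{Ā₁(x − x_s), Ā₂(x − x_s)}` for every `x ∈ [−2,2]²`. -/
theorem tight_ldi :
    ∀ x : Fin 2 → ℝ, x 0 ∈ Set.Icc (-2 : ℝ) 2 → x 1 ∈ Set.Icc (-2 : ℝ) 2 →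
      (![(2 : ℝ) ^ (x 0) + x 1, x 0 + 2 * x 1] - ![(1 : ℝ), -1]) ∈
        convexHull ℝ
          {(!![(0.5 : ℝ), 1; 1, 2]).mulVec (x - ![(1 : ℝ), -1]),
           (!![(2 : ℝ), 1; 1, 2]).mulVec (x - ![(1 : ℝ), -1])} := by
  intro x hx _
  obtain ⟨s, ⟨hs_lower, hs_upper⟩, hs⟩ := exists_two_rpow_sub_two_eq_mul hx
  rw [convexHull_pair]
  refine ⟨(2 - s) / 1.5, (s - 0.5) / 1.5, div_nonneg (by linarith) (by norm_num),
    div_nonneg (by linarith) (by norm_num), by ring, ?_⟩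
  ext i
  fin_cases i
  · simp [vecHead, vecTail]
    linear_combination -hs
  · simp [vecHead, vecTail]
    ring
end
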